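/- A finitely generated abelian group is absolutely closed in N₂ if and only if it is cyclic. -/

import Mathlib

universe u

/-- A group is nilpotent of class at most 2 (lies in `N₂`) if its commutator
subgroup is contained in its center. -/
def IsNil2 (G : Type*) [Group G] : Prop :=
  commutator G ≤ Subgroup.center G

/-- The dominion of a subgroup `B` of `A` in the variety `N₂`: the set of `a ∈ A`
such that any two homomorphisms from `A` to a nil-2 group agreeing on `B` agree at `a`. -/
def Dominion {A : Type u} [Group A] (B : Subgroup A) : Set A :=
  {a | ∀ (C : Type u) [Group C], IsNil2 C →
    ∀ f g : A →* C, (∀ b ∈ B, f b = g b) → f a = g a}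

/-- A group `B` is absolutely closed in `N₂` if for every nil-2 group `A`
containing (a copy of) `B` as a subgroup, the dominion of `B` in `A` is `B`. -/
def IsAbsolutelyClosed (B : Type u) [Group B] : Prop :=
  ∀ (A : Type u) [Group A], IsNil2 A →
    ∀ ι : B →* A, Function.Injective ι →
      Dominion ι.range = (ι.range : Set A)


open scoped TensorProduct commutatorElement IsMulCommutative

/-- Finitely generated abelian groups are finite products of cyclic groups. -/
theorem fg_equiv_pi_zmod (M : Type*) [AddCommGroup M] [AddGroup.FG M] :
    ∃ (ι : Type) (_ : Fintype ι) (n : ι → ℕ), Nonempty (M ≃+ ((i : ι) → ZMod (n i))) := by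
  classical
  obtain ⟨k, ι, hι, p, hp, e, ⟨f⟩⟩ := AddCommGroup.equiv_free_prod_directSum_zmod M
  refine ⟨Fin k ⊕ ι, inferInstance, Sum.elim (fun _ => 0) (fun i => p i ^ e i), ⟨?_⟩⟩
  let g1 : (Fin k →₀ ℤ) ≃+ (Fin k → ℤ) := (Finsupp.linearEquivFunOnFinite ℤ ℤ (Fin k)).toAddEquiv
  let g2 : (DirectSum ι fun i => ZMod (p i ^ e i)) ≃+ ((i : ι) → ZMod (p i ^ e i)) :=
    DirectSum.addEquivProd _
  refine f.trans ((g1.prodCongr g2).trans ?_)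
  exact
    { toFun := fun x i => match i with
        | Sum.inl i => x.1 i
        | Sum.inr i => x.2 i
      invFun := fun x => (fun i => x (Sum.inl i), fun i => x (Sum.inr i))
      left_inv := fun x => rfl
      right_inv := fun x => by
        funext i
        cases i <;> rfl
      map_add' := fun x y => by
        funext i
        cases i <;> rfl }

/-- The arithmetic heart of the cyclic case. -/
theorem arith_key (d ni nj yi yj zi zj : ℤ)
    (h1 : d ∣ ni * yi - zi * ni) (h2 : d ∣ nj * yj - zj * nj)
    (h3 : d ∣ ni * yj - zi * nj) (h4 : d ∣ nj * yi - zj * ni) :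
    d ∣ ni * yj - nj * yi := by
  by_cases h0 : ni = 0 ∧ nj = 0
  · obtain ⟨rfl, rfl⟩ := h0
    simp
  obtain ⟨g, a, c, hg, hac, rfl, rfl⟩ : ∃ g a c : ℤ, g ≠ 0 ∧ IsCoprime a c ∧ ni = g * a ∧ nj = g * c := by
    have hg : Int.gcd ni nj ≠ 0 := by
      rw [Ne, Int.gcd_eq_zero_iff]; exact h0
    obtain ⟨a, ha⟩ := Int.gcd_dvd_left ni nj
    obtain ⟨c, hc⟩ := Int.gcd_dvd_right ni nj
    refine ⟨Int.gcd ni nj, a, c, by exact_mod_cast hg, ?_, ha, hc⟩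
    have hb := Int.gcd_eq_gcd_ab ni nj
    refine ⟨Int.gcdA ni nj, Int.gcdB ni nj, ?_⟩
    have hg' : (Int.gcd ni nj : ℤ) ≠ 0 := by exact_mod_cast hg
    apply mul_left_cancel₀ hg'
    calc _ = (Int.gcd ni nj * a) * Int.gcdA ni nj + (Int.gcd ni nj * c) * Int.gcdB ni nj := by ring
      _ = ni * Int.gcdA ni nj + nj * Int.gcdB ni nj := by rw [← ha, ← hc]
      _ = _ := by rw [← hb, mul_one]
  obtain ⟨u, v, huv⟩ := hac
  have e1 : d ∣ (g * a * yj - g * c * yi) * a := by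
    have := dvd_sub (dvd_mul_of_dvd_right h3 a) (dvd_mul_of_dvd_right h1 c)
    have e : (g * a * yj - g * c * yi) * a =
        a * (g * a * yj - zi * (g * c)) - c * (g * a * yi - zi * (g * a)) := by ring
    rw [e]; exact this
  have e2 : d ∣ (g * a * yj - g * c * yi) * c := by
    have := dvd_sub (dvd_mul_of_dvd_right h2 a) (dvd_mul_of_dvd_right h4 c)
    have e : (g * a * yj - g * c * yi) * c =
        a * (g * c * yj - zj * (g * c)) - c * (g * c * yi - zj * (g * a)) := by ring
    rw [e]; exact this
  have := dvd_add (dvd_mul_of_dvd_right e1 u) (dvd_mul_of_dvd_right e2 v)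
  have e : g * a * yj - g * c * yi = u * ((g * a * yj - g * c * yi) * a) +
      v * ((g * a * yj - g * c * yi) * c) := by
    linear_combination (-(g * a * yj - g * c * yi)) * huv
  rw [e]; exact this

theorem alt_fg {M V : Type*} [AddCommGroup M] [AddGroup.FG M] [AddCommGroup V]
    (w : M →ₗ[ℤ] M →ₗ[ℤ] V) (hw : ∀ x, w x x = 0) (b y z : M)
    (h : b ⊗ₜ[ℤ] y = z ⊗ₜ[ℤ] b) : w b y = 0 := by
  classical
  obtain ⟨ι, hι, n, ⟨e⟩⟩ := fg_equiv_pi_zmod M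
  have hlift : ∀ x : M, ∃ c : ι → ℤ, ∀ i, ((c i : ℤ) : ZMod (n i)) = e x i := fun x => by
    choose c hc using fun i => ZMod.intCast_surjective (e x i)
    exact ⟨c, hc⟩
  choose c hc using hlift
  let E : ι → M := fun i => e.symm (Pi.single i 1)
  have hx : ∀ x, x = ∑ i, c x i • E i := by
    intro x
    apply e.injective
    rw [map_sum]
    funext j
    rw [Finset.sum_apply, Finset.sum_eq_single j]
    · simp [E, hc]
    · intro i _ hij
      simp [E, Pi.single_eq_of_ne hij.symm]
    · simp
  have hE : ∀ i, (n i : ℤ) • E i = 0 := by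
    intro i
    apply e.injective
    funext j
    by_cases hij : j = i
    · subst hij; simp [E]
    · simp [E, Pi.single_eq_of_ne hij]
  have hanti : ∀ x x', w x x' = - w x' x := by
    intro x x'
    have := hw (x + x')
    simp only [map_add, LinearMap.add_apply, hw, zero_add, add_zero] at this
    exact eq_neg_of_add_eq_zero_right this
  -- coordinates of the tensor relation
  have hT : ∀ i j, ((Nat.gcd (n i) (n j) : ℕ) : ℤ) ∣ c b i * c y j - c z i * c b j := by
    intro i j
    set d := Nat.gcd (n i) (n j) with hd
    let p1 : M →+ ZMod d := (ZMod.castHom (Nat.gcd_dvd_left (n i) (n j)) (ZMod d)).toAddMonoidHom.comp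
      ((Pi.evalAddMonoidHom _ i).comp e.toAddMonoidHom)
    let p2 : M →+ ZMod d := (ZMod.castHom (Nat.gcd_dvd_right (n i) (n j)) (ZMod d)).toAddMonoidHom.comp
      ((Pi.evalAddMonoidHom _ j).comp e.toAddMonoidHom)
    have hp1 : ∀ x, p1 x = ((c x i : ℤ) : ZMod d) := by
      intro x
      change ZMod.castHom (Nat.gcd_dvd_left (n i) (n j)) (ZMod d) (e x i) = _
      rw [← hc x i, map_intCast]
    have hp2 : ∀ x, p2 x = ((c x j : ℤ) : ZMod d) := by
      intro x
      change ZMod.castHom (Nat.gcd_dvd_right (n i) (n j)) (ZMod d) (e x j) = _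
      rw [← hc x j, map_intCast]
    have := congrArg (LinearMap.mul' ℤ (ZMod d))
      (congrArg (TensorProduct.map p1.toIntLinearMap p2.toIntLinearMap) h)
    simp only [TensorProduct.map_tmul, LinearMap.mul'_apply, AddMonoidHom.coe_toIntLinearMap, hp1, hp2] at this
    rw [← ZMod.intCast_zmod_eq_zero_iff_dvd] 
    push_cast
    rw [this, sub_self]
  have hd : ∀ i j, ((Nat.gcd (n i) (n j) : ℕ) : ℤ) • w (E i) (E j) = 0 := by
    intro i j
    have e1 : (n i : ℤ) • w (E i) (E j) = 0 := by
      rw [← LinearMap.smul_apply, ← map_smul, hE, map_zero, LinearMap.zero_apply]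
    have e2 : (n j : ℤ) • w (E i) (E j) = 0 := by
      rw [← map_smul (w (E i)), hE, map_zero]
    rw [Nat.gcd_eq_gcd_ab, add_smul, mul_comm, mul_smul, mul_comm (n j : ℤ), mul_smul, e1, e2]
    simp
  have hpair : ∀ i j, (c b i * c y j) • w (E i) (E j) + (c b j * c y i) • w (E j) (E i) = 0 := by
    intro i j
    rw [hanti (E j) (E i), smul_neg, ← sub_eq_add_neg, ← sub_smul]
    have h1 := hT i i
    have h2 := hT j j
    rw [Nat.gcd_self] at h1 h2
    have h4 := hT j i
    rw [Nat.gcd_comm] at h4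
    obtain ⟨r, hr⟩ := arith_key _ _ _ _ _ _ _
      ((Int.natCast_dvd_natCast.2 (Nat.gcd_dvd_left (n i) (n j))).trans h1)
      ((Int.natCast_dvd_natCast.2 (Nat.gcd_dvd_right (n i) (n j))).trans h2) (hT i j) h4
    rw [hr, mul_comm, mul_smul, hd, smul_zero]
  rw [hx b, hx y]
  simp only [map_sum, LinearMap.sum_apply, map_smul, LinearMap.smul_apply, Finset.smul_sum, smul_smul]
  rw [← Finset.sum_product']
  refine Finset.sum_involution (fun a _ => a.swap) ?_ ?_ ?_ ?_
  · rintro ⟨i, j⟩ _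
    have := hpair i j
    have := hpair j i
    simp only [Prod.swap]
    simpa [mul_comm] using this
  · rintro ⟨i, j⟩ _ hne heq
    simp only [Prod.swap, Prod.mk.injEq] at heq
    obtain ⟨rfl, -⟩ := heq
    apply hne
    simp [hw]
  · simp
  · simp

theorem alt_gen {M V : Type*} [AddCommGroup M] [AddCommGroup V]
    (w : M →ₗ[ℤ] M →ₗ[ℤ] V) (hw : ∀ x, w x x = 0) (b y z : M)
    (h : b ⊗ₜ[ℤ] y = z ⊗ₜ[ℤ] b) : w b y = 0 := by
  have mem : ∀ x : M, x ∈ Submodule.span ℤ {x} := fun x => Submodule.mem_span_singleton_self x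
  obtain ⟨Q1, hb1, hz1, hQ1, h1⟩ := TensorProduct.eq_of_fg_of_subtype_eq' (R := ℤ) (M := M) (N := M)
    (Submodule.fg_span_singleton b) (Submodule.fg_span_singleton z)
    (t := ⟨b, mem b⟩ ⊗ₜ y) (t' := ⟨z, mem z⟩ ⊗ₜ b) (by simpa using h)
  simp only [LinearMap.rTensor_tmul] at h1
  have h1' := congrArg (TensorProduct.comm ℤ _ _) h1
  simp only [TensorProduct.comm_tmul] at h1'
  obtain ⟨Q2, hy2, hb2, hQ2, h2⟩ := TensorProduct.eq_of_fg_of_subtype_eq' (R := ℤ) (M := M) (N := Q1)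
    (Submodule.fg_span_singleton y) (Submodule.fg_span_singleton b)
    (t := ⟨y, mem y⟩ ⊗ₜ _) (t' := ⟨b, mem b⟩ ⊗ₜ _) (by simpa using h1')
  simp only [LinearMap.rTensor_tmul] at h2
  let Q := Q1 ⊔ Q2
  have hQ : Q.FG := hQ1.sup hQ2
  have h3 := congrArg (TensorProduct.comm ℤ _ _) (congrArg (TensorProduct.map
    (Submodule.inclusion (le_sup_right : Q2 ≤ Q)) (Submodule.inclusion (le_sup_left : Q1 ≤ Q))) h2)
  simp only [TensorProduct.map_tmul, TensorProduct.comm_tmul] at h3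
  have : Module.Finite ℤ Q := Module.Finite.iff_fg.2 hQ
  have : AddGroup.FG Q := Module.Finite.iff_addGroup_fg.1 this
  exact alt_fg (w.compl₁₂ Q.subtype Q.subtype) (fun x => hw x) _ _ _ h3

theorem IsNil2.comm {A : Type*} [Group A] (hA : IsNil2 A) (x y z : A) :
    ⁅x, y⁆ * z = z * ⁅x, y⁆ :=
  (Subgroup.mem_center_iff.1 (hA (Subgroup.commutator_mem_commutator
    (Subgroup.mem_top x) (Subgroup.mem_top y))) z).symm

theorem isNil2_of_comm {A : Type*} [Group A] (h : ∀ x y z : A, ⁅x, y⁆ * z = z * ⁅x, y⁆) :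
    IsNil2 A := by
  unfold IsNil2
  rw [commutator_def, Subgroup.commutator_le]
  intro x _ y _
  exact Subgroup.mem_center_iff.2 fun z => (h x y z).symm

theorem isNil2_of_surjective {A B : Type*} [Group A] [Group B] (hA : IsNil2 A) (f : A →* B)
    (hf : Function.Surjective f) : IsNil2 B := by
  refine isNil2_of_comm fun x y z => ?_
  obtain ⟨x, rfl⟩ := hf x
  obtain ⟨y, rfl⟩ := hf y
  obtain ⟨z, rfl⟩ := hf z
  rw [← map_commutatorElement, ← map_mul, hA.comm, map_mul]

/-- The map `x ↦ ⁅a, x⁆` is a homomorphism in a nil-2 group. -/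
def IsNil2.commHom {A : Type*} [Group A] (hA : IsNil2 A) (a : A) : A →* A :=
  MonoidHom.mk' (fun x => ⁅a, x⁆) fun x y => by
    rw [commutatorElement_mul_right_eq_mul_conj, mul_assoc _ x, ← hA.comm a y x]
    group

theorem IsNil2.comm_mul_right {A : Type*} [Group A] (hA : IsNil2 A) (a x y : A) :
    ⁅a, x * y⁆ = ⁅a, x⁆ * ⁅a, y⁆ := map_mul (hA.commHom a) x y

theorem IsNil2.comm_zpow_right {A : Type*} [Group A] (hA : IsNil2 A) (a x : A) (n : ℤ) :
    ⁅a, x ^ n⁆ = ⁅a, x⁆ ^ n := map_zpow (hA.commHom a) x n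

theorem IsNil2.comm_inv_right {A : Type*} [Group A] (hA : IsNil2 A) (a x : A) :
    ⁅a, x⁻¹⁆ = ⁅a, x⁆⁻¹ := map_inv (hA.commHom a) x

theorem IsNil2.comm_pow_right {A : Type*} [Group A] (hA : IsNil2 A) (a x : A) (n : ℕ) :
    ⁅a, x ^ n⁆ = ⁅a, x⁆ ^ n := map_pow (hA.commHom a) x n

theorem IsNil2.comm_mul_left {A : Type*} [Group A] (hA : IsNil2 A) (x y a : A) :
    ⁅x * y, a⁆ = ⁅x, a⁆ * ⁅y, a⁆ := by
  rw [← commutatorElement_inv, hA.comm_mul_right, mul_inv_rev, commutatorElement_inv,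
    commutatorElement_inv, hA.comm]

theorem IsNil2.comm_pow_left {A : Type*} [Group A] (hA : IsNil2 A) (x a : A) (n : ℕ) :
    ⁅x ^ n, a⁆ = ⁅x, a⁆ ^ n := by
  rw [← commutatorElement_inv, hA.comm_pow_right, ← inv_pow, commutatorElement_inv]

theorem IsNil2.comm_zpow_left {A : Type*} [Group A] (hA : IsNil2 A) (x a : A) (n : ℤ) :
    ⁅x ^ n, a⁆ = ⁅x, a⁆ ^ n := by
  rw [← commutatorElement_inv, hA.comm_zpow_right, ← inv_zpow, commutatorElement_inv]

/-- The class of an element in the additive abelianization. -/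
def abc {A : Type*} [Group A] (x : A) : Additive (Abelianization A) :=
  Additive.ofMul (Abelianization.of x)

theorem abc_mul {A : Type*} [Group A] (x y : A) : abc (x * y) = abc x + abc y := by
  simp [abc]

theorem abc_one {A : Type*} [Group A] : abc (1 : A) = 0 := by
  simp [abc]

theorem abc_inv {A : Type*} [Group A] (x : A) : abc x⁻¹ = - abc x := by
  simp [abc]

theorem abc_zpow {A : Type*} [Group A] (x : A) (n : ℤ) : abc (x ^ n) = n • abc x := by
  simp [abc]

theorem abc_comm {A : Type*} [Group A] (x y : A) : abc ⁅x, y⁆ = 0 := by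
  simp [abc, commutatorElement_def]

theorem abc_surj {A : Type*} [Group A] (m : Additive (Abelianization A)) : ∃ x, abc x = m := by
  obtain ⟨x, hx⟩ := QuotientGroup.mk_surjective (Additive.toMul m)
  exact ⟨x, hx⟩

/-- The commutator as a map to the centre. -/
def IsNil2.cc {A : Type*} [Group A] (hA : IsNil2 A) (x y : A) : Subgroup.center A :=
  ⟨⁅x, y⁆, hA (Subgroup.commutator_mem_commutator
    (Subgroup.mem_top x) (Subgroup.mem_top y))⟩

/-- The commutator pairing, in multiplicative form. -/
def IsNil2.pairing {A : Type*} [Group A] (hA : IsNil2 A) :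
    Abelianization A →* (Abelianization A →* Subgroup.center A) :=
  Abelianization.lift (MonoidHom.mk' (fun x => Abelianization.lift
    (MonoidHom.mk' (fun y => hA.cc x y)
      (fun y y' => Subtype.ext (hA.comm_mul_right x y y'))))
    (fun x x' => by
      ext y
      simpa [IsNil2.cc] using hA.comm_mul_left x x' y))

theorem IsNil2.tensor_key {A : Type*} [Group A] (hA : IsNil2 A) (b y z : A)
    (h : abc b ⊗ₜ[ℤ] abc y = abc z ⊗ₜ[ℤ] abc b) : ⁅b, y⁆ = 1 := by
  let w : Additive (Abelianization A) →+ Additive (Abelianization A) →+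
      Additive (Subgroup.center A) :=
    AddMonoidHom.mk' (fun m => MonoidHom.toAdditive (hA.pairing (Additive.toMul m)))
      (fun m m' => by ext y; simp)
  let w' : Additive (Abelianization A) →ₗ[ℤ] Additive (Abelianization A) →ₗ[ℤ]
      Additive (Subgroup.center A) :=
    AddMonoidHom.toIntLinearMap (AddMonoidHom.mk' (fun m => (w m).toIntLinearMap)
      (fun m m' => by ext y; simp))
  have hw : ∀ x y : A, w' (abc x) (abc y) = Additive.ofMul (hA.cc x y) := fun x y => rfl
  have := alt_gen w' (fun m => by
    obtain ⟨x, rfl⟩ := abc_surj m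
    rw [hw]
    apply Additive.toMul.injective
    apply Subtype.ext
    exact commutatorElement_self x) (abc b) (abc y) (abc z) h
  rw [hw] at this
  exact congrArg (fun t => ((Additive.toMul t : Subgroup.center A) : A)) this

/-- Bimultiplicative maps. -/
structure Bim (P V : Type*) [Group P] [AddCommGroup V] where
  /-- the underlying function -/
  f : P → P → V
  hl : ∀ x y z, f (x * y) z = f x z + f y z
  hr : ∀ x y z, f x (y * z) = f x y + f x z

section Bim
variable {P V : Type*} [Group P] [AddCommGroup V] (τ : Bim P V)

theorem Bim.one_left (x : P) : τ.f 1 x = 0 := by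
  have := τ.hl 1 1 x
  simpa using this

theorem Bim.one_right (x : P) : τ.f x 1 = 0 := by
  have := τ.hr x 1 1
  simpa using this

theorem Bim.inv_left (x y : P) : τ.f x⁻¹ y = - τ.f x y := by
  have := τ.hl x⁻¹ x y
  rw [inv_mul_cancel, τ.one_left] at this
  exact eq_neg_of_add_eq_zero_left this.symm

theorem Bim.inv_right (x y : P) : τ.f x y⁻¹ = - τ.f x y := by
  have := τ.hr x y⁻¹ y
  rw [inv_mul_cancel, τ.one_right] at this
  exact eq_neg_of_add_eq_zero_left this.symm

theorem Bim.comm_left (x y z : P) : τ.f ⁅x, y⁆ z = 0 := by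
  simp only [commutatorElement_def, τ.hl, τ.inv_left]
  abel

theorem Bim.comm_right (x y z : P) : τ.f z ⁅x, y⁆ = 0 := by
  simp only [commutatorElement_def, τ.hr, τ.inv_right]
  abel

/-- The central extension of `P` by `V` with cocycle `τ`. -/
@[ext]
structure CExt (τ : Bim P V) where
  /-- base component -/
  p : P
  /-- central component -/
  v : V

instance : Mul (CExt τ) := ⟨fun x y => ⟨x.p * y.p, x.v + y.v + τ.f x.p y.p⟩⟩
instance : One (CExt τ) := ⟨⟨1, 0⟩⟩
instance : Inv (CExt τ) := ⟨fun x => ⟨x.p⁻¹, - x.v + τ.f x.p x.p⟩⟩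

theorem CExt.mul_p (x y : CExt τ) : (x * y).p = x.p * y.p := rfl
theorem CExt.mul_v (x y : CExt τ) : (x * y).v = x.v + y.v + τ.f x.p y.p := rfl
theorem CExt.one_p : (1 : CExt τ).p = 1 := rfl
theorem CExt.one_v : (1 : CExt τ).v = 0 := rfl
theorem CExt.inv_p (x : CExt τ) : (x⁻¹).p = x.p⁻¹ := rfl
theorem CExt.inv_v (x : CExt τ) : (x⁻¹).v = - x.v + τ.f x.p x.p := rfl

instance : Group (CExt τ) :=
  Group.ofLeftAxioms
    (fun x y z => by
      ext
      · simp only [CExt.mul_p, mul_assoc]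
      · simp only [CExt.mul_p, CExt.mul_v, τ.hl, τ.hr]
        abel)
    (fun x => by
      ext
      · simp only [CExt.mul_p, CExt.one_p, one_mul]
      · simp only [CExt.mul_v, CExt.one_p, CExt.one_v, τ.one_left]
        abel)
    (fun x => by
      ext
      · simp only [CExt.mul_p, CExt.inv_p, CExt.one_p, inv_mul_cancel]
      · simp only [CExt.mul_v, CExt.inv_p, CExt.inv_v, CExt.one_v, τ.inv_left]
        abel)

/-- projection to the base -/
def CExt.proj : CExt τ →* P := MonoidHom.mk' (fun x => x.p) (fun _ _ => rfl)

theorem CExt.comm_p (x y : CExt τ) : (⁅x, y⁆).p = ⁅x.p, y.p⁆ :=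
  map_commutatorElement (CExt.proj τ) x y

theorem CExt.comm_v (x y : CExt τ) : (⁅x, y⁆).v = τ.f x.p y.p - τ.f y.p x.p := by
  have h : ⁅x, y⁆ * (y * x) = x * y := by
    rw [commutatorElement_def]; group
  have := congrArg CExt.v h
  simp only [CExt.mul_v, CExt.mul_p, CExt.comm_p, τ.comm_left] at this
  rw [← sub_eq_zero] at this ⊢
  rw [← this]
  abel

theorem CExt.isNil2 (hP : IsNil2 P) : IsNil2 (CExt τ) := by
  refine isNil2_of_comm fun x y z => ?_
  ext
  · simp only [CExt.mul_p, CExt.comm_p, hP.comm]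
  · simp only [CExt.mul_v, CExt.comm_p, τ.comm_left, τ.comm_right]
    abel

end Bim

section Cyclic
universe v
variable {A : Type v} [Group A]

/-- The cocycle defining the nil-2 coproduct of two copies of `A`. -/
def coprodBim (A : Type v) [Group A] :
    Bim (A × A) (Additive (Abelianization A) ⊗[ℤ] Additive (Abelianization A)) where
  f x y := abc x.2 ⊗ₜ abc y.1
  hl x y z := by rw [Prod.snd_mul, abc_mul, TensorProduct.add_tmul]
  hr x y z := by rw [Prod.fst_mul, abc_mul, TensorProduct.tmul_add]

theorem coprodBim_f (x y : A × A) : (coprodBim A).f x y = abc x.2 ⊗ₜ abc y.1 := rfl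

/-- The kernel of the map to the amalgamated coproduct over a cyclic subgroup. -/
def amalgKer (hA : IsNil2 A) (b : A) : Subgroup (CExt (coprodBim A)) where
  carrier := {X | ∃ (k : ℤ) (y z : A), X.p.1 = b ^ k * ⁅b, y⁆ ∧ X.p.2 = b ^ (-k) * ⁅b, z⁆ ∧
    X.v = abc z ⊗ₜ abc b - abc b ⊗ₜ abc y}
  one_mem' := ⟨0, 1, 1, by simp [CExt.one_p], by simp [CExt.one_p], by simp [CExt.one_v, abc_one]⟩
  mul_mem' := by
    rintro X X' ⟨k, y, z, h1, h2, h3⟩ ⟨k', y', z', h1', h2', h3'⟩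
    refine ⟨k + k', y * y' * b ^ (k * k'), z * z', ?_, ?_, ?_⟩
    · rw [CExt.mul_p, Prod.fst_mul, h1, h1', hA.comm_mul_right, hA.comm_mul_right,
        hA.comm_zpow_right b b, commutatorElement_self, one_zpow, mul_one, zpow_add,
        mul_assoc (b ^ k), ← mul_assoc ⁅b, y⁆, hA.comm b y (b ^ k')]
      simp only [mul_assoc]
    · rw [CExt.mul_p, Prod.snd_mul, h2, h2', hA.comm_mul_right, neg_add, zpow_add,
        mul_assoc (b ^ (-k)), ← mul_assoc ⁅b, z⁆, hA.comm b z (b ^ (-k'))]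
      simp only [mul_assoc]
    · rw [CExt.mul_v, h3, h3']
      simp only [coprodBim, h2, h1', abc_mul, abc_comm, abc_zpow, add_zero,
        TensorProduct.tmul_add, TensorProduct.add_tmul, TensorProduct.tmul_smul,
        TensorProduct.smul_tmul', mul_smul, neg_smul, TensorProduct.neg_tmul, smul_neg]
      rw [smul_comm k' k]
      abel
  inv_mem' := by
    rintro X ⟨k, y, z, h1, h2, h3⟩
    refine ⟨-k, y⁻¹ * b ^ (k * k), z⁻¹, ?_, ?_, ?_⟩
    · rw [CExt.inv_p, Prod.fst_inv, h1, hA.comm_mul_right,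
        hA.comm_zpow_right b b, commutatorElement_self, one_zpow, mul_one, hA.comm_inv_right,
        ← hA.comm, mul_inv_rev, zpow_neg]
    · rw [CExt.inv_p, Prod.snd_inv, h2, hA.comm_inv_right, ← hA.comm, mul_inv_rev, zpow_neg (b) (-k)]
    · rw [CExt.inv_v, h3]
      simp only [coprodBim, h2, h1, abc_mul, abc_comm, abc_zpow, abc_inv, add_zero,
        TensorProduct.tmul_add, TensorProduct.add_tmul, TensorProduct.tmul_smul,
        TensorProduct.smul_tmul', mul_smul, neg_smul, TensorProduct.neg_tmul, smul_neg,
        TensorProduct.tmul_neg]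
      abel

theorem amalgKer_normal (hA : IsNil2 A) (b : A) : (amalgKer hA b).Normal := by
  constructor
  rintro X ⟨k, y, z, h1, h2, h3⟩ U
  have e : U * X * U⁻¹ = ⁅U, X⁆ * X := by rw [commutatorElement_def]; group
  rw [e]
  have aux : ∀ (u y : A) (n : ℤ), ⁅u, b ^ n * ⁅b, y⁆⁆ = ⁅b, u ^ (-n)⁆ := by
    intro u y n
    have h0 : ⁅u, ⁅b, y⁆⁆ = 1 := by
      rw [commutatorElement_eq_one_iff_mul_comm, hA.comm]
    rw [hA.comm_mul_right, h0, mul_one, hA.comm_zpow_right, hA.comm_zpow_right, zpow_neg,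
      ← inv_zpow, commutatorElement_inv]
  refine ⟨k, U.p.1 ^ (-k) * y, U.p.2 ^ k * z, ?_, ?_, ?_⟩
  · rw [CExt.mul_p, CExt.comm_p, Prod.fst_mul]
    change ⁅U.p.1, X.p.1⁆ * X.p.1 = _
    rw [h1, aux, hA.comm_mul_right, hA.comm b (U.p.1 ^ (-k)), mul_assoc, hA.comm b y]
  · rw [CExt.mul_p, CExt.comm_p, Prod.snd_mul]
    change ⁅U.p.2, X.p.2⁆ * X.p.2 = _
    rw [h2, aux, neg_neg, hA.comm_mul_right, hA.comm b (U.p.2 ^ k), mul_assoc, hA.comm b z]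
  · rw [CExt.mul_v, CExt.comm_v, CExt.comm_p, (coprodBim A).comm_left, h3]
    simp only [coprodBim, h2, h1, abc_mul, abc_comm, abc_zpow, abc_inv, add_zero,
        TensorProduct.tmul_add, TensorProduct.add_tmul, TensorProduct.tmul_smul,
        TensorProduct.smul_tmul', mul_smul, neg_smul, TensorProduct.neg_tmul, smul_neg,
        TensorProduct.tmul_neg]
    abel

theorem dominion_zpowers (hA : IsNil2 A) (b a : A) (ha : a ∈ Dominion (Subgroup.zpowers b)) :
    a ∈ Subgroup.zpowers b := by
  let K : Subgroup (CExt (coprodBim A)) := amalgKer hA b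
  have hK : K.Normal := amalgKer_normal hA b
  have hAA : IsNil2 (A × A) := isNil2_of_comm fun x y z => by
    ext
    · exact hA.comm x.1 y.1 z.1
    · exact hA.comm x.2 y.2 z.2
  have hE : IsNil2 (CExt (coprodBim A)) := CExt.isNil2 _ hAA
  let i1 : A →* (CExt (coprodBim A)) := MonoidHom.mk' (fun x => ⟨(x, 1), 0⟩) (fun x y => by
    ext
    · simp [CExt.mul_p]
    · simp [CExt.mul_p]
    · simp [CExt.mul_v, coprodBim_f, abc_one])
  let i2 : A →* (CExt (coprodBim A)) := MonoidHom.mk' (fun x => ⟨(1, x), 0⟩) (fun x y => by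
    ext
    · simp [CExt.mul_p]
    · simp [CExt.mul_p]
    · simp [CExt.mul_v, coprodBim_f, abc_one])
  have hi : ∀ x, (i1 x)⁻¹ * i2 x = ⟨(x⁻¹, x), 0⟩ := by
    intro x
    ext
    · simp [CExt.mul_p, CExt.inv_p, i1, i2]
    · simp [CExt.mul_p, CExt.inv_p, i1, i2]
    · simp [CExt.mul_v, CExt.inv_v, CExt.inv_p, i1, i2, coprodBim_f, abc_one]
  have hq : IsNil2 ((CExt (coprodBim A)) ⧸ K) := isNil2_of_surjective hE (QuotientGroup.mk' K)
    (QuotientGroup.mk'_surjective K)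
  have h := ha ((CExt (coprodBim A)) ⧸ K) hq ((QuotientGroup.mk' K).comp i1) ((QuotientGroup.mk' K).comp i2) (by
    rintro _ ⟨n, rfl⟩
    refine QuotientGroup.eq.2 ?_
    change (i1 (b ^ n))⁻¹ * i2 (b ^ n) ∈ K
    rw [hi]
    exact ⟨-n, 1, 1, by simp, by simp, by simp [abc_one]⟩)
  have h' : (i1 a)⁻¹ * i2 a ∈ K := QuotientGroup.eq.1 h
  rw [hi] at h'
  obtain ⟨k, y, z, h1, -, h3⟩ := h'
  have := hA.tensor_key b y z (sub_eq_zero.1 h3.symm).symm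
  change a⁻¹ = _ at h1
  rw [this, mul_one] at h1
  exact ⟨-k, by simp [zpow_neg, ← h1]⟩

theorem cyclic_absolutelyClosed (B : Type v) [Group B] [IsCyclic B] : IsAbsolutelyClosed B := by
  intro A _ hA ι _
  obtain ⟨g, hg⟩ := IsCyclic.exists_zpow_surjective (G := B)
  have hr : ι.range = Subgroup.zpowers (ι g) := by
    ext x
    constructor
    · rintro ⟨y, rfl⟩
      obtain ⟨n, rfl⟩ := hg y
      exact ⟨n, by simp⟩
    · rintro ⟨n, rfl⟩
      exact ⟨g ^ n, by simp⟩
  rw [hr]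
  ext a
  constructor
  · exact dominion_zpowers hA _ _
  · intro ha C _ _ f g' hfg
    exact hfg a ha

end Cyclic

theorem exists_dual_pair (M : Type*) [AddCommGroup M] [AddGroup.FG M] (hM : ¬ IsAddCyclic M) :
    ∃ (p : ℕ) (_ : p.Prime) (c1 c2 : M) (f1 f2 : M →+ ZMod (p ^ 2)),
      f1 c1 = p ∧ f1 c2 = 0 ∧ f2 c1 = 0 ∧ f2 c2 = p ∧ ∀ x y, f1 x * f2 y = 0 := by
  classical
  obtain ⟨ι, hι, n, ⟨e⟩⟩ := fg_equiv_pi_zmod M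
  have hnc : ¬ Pairwise (Function.onFun Nat.Coprime n) := by
    intro hc
    apply hM
    let E : ZMod (∏ i, n i) ≃+ M := (ZMod.prodEquivPi n hc).toAddEquiv.trans e.symm
    exact isAddCyclic_of_surjective E E.surjective
  rw [Pairwise] at hnc
  push Not at hnc
  obtain ⟨i, j, hij, hc⟩ := hnc
  obtain ⟨p, hp, hpi, hpj⟩ := Nat.Prime.not_coprime_iff_dvd.1 hc
  let m : ZMod p →+ ZMod (p ^ 2) := ZMod.lift p ⟨(zmultiplesHom (ZMod (p ^ 2))) (p : ZMod (p ^ 2)), by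
    simp only [zmultiplesHom_apply, zsmul_eq_mul, Int.cast_natCast]
    rw [← pow_two]
    exact_mod_cast ZMod.natCast_self (p ^ 2)⟩
  have hm : ∀ a : ℤ, m (a : ZMod p) = a * (p : ZMod (p ^ 2)) := by
    intro a
    simp [m]
  have hm1 : m 1 = (p : ZMod (p ^ 2)) := by
    simpa using hm 1
  let f : ∀ i, p ∣ n i → (M →+ ZMod (p ^ 2)) := fun i hi =>
    m.comp ((ZMod.castHom hi (ZMod p)).toAddMonoidHom.comp
      ((Pi.evalAddMonoidHom _ i).comp e.toAddMonoidHom))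
  have hf : ∀ i hi x, f i hi x = m (ZMod.castHom hi (ZMod p) (e x i)) := fun _ _ _ => rfl
  refine ⟨p, hp, e.symm (Pi.single i 1), e.symm (Pi.single j 1), f i hpi, f j hpj, ?_, ?_, ?_, ?_, ?_⟩
  · rw [hf, e.apply_symm_apply, Pi.single_eq_same, map_one, hm1]
  · rw [hf, e.apply_symm_apply, Pi.single_eq_of_ne hij, map_zero, map_zero]
  · rw [hf, e.apply_symm_apply, Pi.single_eq_of_ne hij.symm, map_zero, map_zero]
  · rw [hf, e.apply_symm_apply, Pi.single_eq_same, map_one, hm1]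
  · intro x y
    rw [hf, hf]
    obtain ⟨a, ha⟩ := ZMod.intCast_surjective (ZMod.castHom hpi (ZMod p) (e x i))
    obtain ⟨b, hb⟩ := ZMod.intCast_surjective (ZMod.castHom hpj (ZMod p) (e y j))
    have hpp : (p : ZMod (p ^ 2)) * p = 0 := by
      rw [← pow_two]
      exact_mod_cast ZMod.natCast_self (p ^ 2)
    rw [← ha, ← hb, hm, hm]
    linear_combination (a * b : ZMod (p ^ 2)) * hpp

theorem Bim.pow_left {P V : Type*} [Group P] [AddCommGroup V] (τ : Bim P V) (x y : P)
    (h : τ.f x y = 0) (n : ℕ) : τ.f (x ^ n) y = 0 := by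
  induction n with
  | zero => rw [pow_zero, τ.one_left]
  | succ n ih => rw [pow_succ, τ.hl, ih, h, add_zero]

theorem CExt.pow_eq {P V : Type*} [Group P] [AddCommGroup V] (τ : Bim P V) (x : CExt τ)
    (h : τ.f x.p x.p = 0) (n : ℕ) : x ^ n = ⟨x.p ^ n, n • x.v⟩ := by
  induction n with
  | zero =>
    ext
    · simp [CExt.one_p]
    · simp [CExt.one_v]
  | succ n ih =>
    rw [pow_succ, ih]
    ext
    · simp [CExt.mul_p, pow_succ]
    · simp [CExt.mul_v, τ.pow_left _ _ h, succ_nsmul]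

section NonCyclic
universe v

theorem isNil2_of_commGroup (C : Type*) [CommGroup C] : IsNil2 C :=
  isNil2_of_comm fun _ _ _ => mul_comm _ _

theorem not_absolutelyClosed (G : Type v) [CommGroup G] (p : ℕ) (hp : p.Prime)
    (c1 c2 : Additive G) (f1 f2 : Additive G →+ ZMod (p ^ 2))
    (h11 : f1 c1 = p) (h12 : f1 c2 = 0) (h21 : f2 c1 = 0) (h22 : f2 c2 = p)
    (hz : ∀ x y, f1 x * f2 y = 0) : ¬ IsAbsolutelyClosed G := by
  intro hcl
  let ρ : ℤ × ℤ →+ Additive G × ℤ × ℤ := AddMonoidHom.mk'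
    (fun s => (s.1 • c1 + s.2 • c2, (-(p * s.1), -(p * s.2)))) (by
      rintro ⟨s, t⟩ ⟨s', t'⟩
      ext
      · simp only [Prod.mk_add_mk, add_smul]; abel
      · simp only [Prod.mk_add_mk]; ring
      · simp only [Prod.mk_add_mk]; ring)
  let R := ρ.range
  let a1 : Additive G × ℤ × ℤ →+ ZMod (p ^ 2) := AddMonoidHom.mk'
    (fun x => f1 x.1 + (x.2.1 : ZMod (p ^ 2))) (by
      intro x y
      simp only [Prod.fst_add, Prod.snd_add, map_add, Int.cast_add]; ring)
  let a2 : Additive G × ℤ × ℤ →+ ZMod (p ^ 2) := AddMonoidHom.mk'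
    (fun x => f2 x.1 + (x.2.2 : ZMod (p ^ 2))) (by
      intro x y
      simp only [Prod.fst_add, Prod.snd_add, map_add, Int.cast_add]; ring)
  let α1 : (Additive G × ℤ × ℤ) ⧸ R →+ ZMod (p ^ 2) := QuotientAddGroup.lift R a1 (by
    rintro _ ⟨⟨s, t⟩, rfl⟩
    simp [a1, ρ, h11, h12, mul_comm])
  let α2 : (Additive G × ℤ × ℤ) ⧸ R →+ ZMod (p ^ 2) := QuotientAddGroup.lift R a2 (by
    rintro _ ⟨⟨s, t⟩, rfl⟩
    simp [a2, ρ, h21, h22, mul_comm])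
  let H := Multiplicative ((Additive G × ℤ × ℤ) ⧸ R)
  let mk : Additive G × ℤ × ℤ → H := fun x => Multiplicative.ofAdd (QuotientAddGroup.mk x)
  have mk_mul : ∀ x y, mk (x + y) = mk x * mk y := fun _ _ => rfl
  have mk_pow : ∀ (x) (n : ℕ), mk (n • x) = mk x ^ n := fun _ _ => rfl
  let τ : Bim H (ZMod (p ^ 2)) :=
    { f := fun x y => α1 x.toAdd * α2 y.toAdd
      hl := fun x y z => by rw [toAdd_mul, map_add, add_mul]
      hr := fun x y z => by rw [toAdd_mul, map_add, mul_add] }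
  have τmk : ∀ x y, τ.f (mk x) (mk y) =
      (f1 x.1 + (x.2.1 : ZMod (p ^ 2))) * (f2 y.1 + (y.2.2 : ZMod (p ^ 2))) := fun _ _ => rfl
  let j : G →* CExt τ := MonoidHom.mk' (fun g => ⟨mk (Additive.ofMul g, 0), 0⟩) (by
    intro g g'
    ext
    · rw [CExt.mul_p, ← mk_mul]
      rfl
    · rw [CExt.mul_v, τmk]
      simp [hz])
  have jdef : ∀ g, j g = ⟨mk (Additive.ofMul g, 0), 0⟩ := fun _ => rfl
  have hp0 : (p : ℤ) ≠ 0 := by exact_mod_cast hp.ne_zero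
  have hj : Function.Injective j := by
    intro g g' h
    rw [jdef, jdef] at h
    have h1 := congrArg CExt.p h
    have h2 : ((Additive.ofMul g, 0) : Additive G × ℤ × ℤ) - (Additive.ofMul g', 0) ∈ R :=
      (QuotientAddGroup.eq_iff_sub_mem).1 (Multiplicative.ofAdd.injective h1)
    obtain ⟨⟨s, t⟩, hst⟩ := h2
    simp only [ρ, AddMonoidHom.mk'_apply, Prod.mk_sub_mk, Prod.ext_iff, Prod.fst_sub, Prod.snd_sub,
      sub_self, Prod.fst_zero, Prod.snd_zero, neg_eq_zero, mul_eq_zero, hp0, false_or] at hst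
    obtain ⟨h3, rfl, rfl⟩ := hst
    rw [zero_smul, zero_smul, add_zero] at h3
    exact Additive.ofMul.injective (sub_eq_zero.1 h3.symm)
  have hA : IsNil2 (CExt τ) := CExt.isNil2 τ (isNil2_of_commGroup H)
  have hdom := hcl (CExt τ) hA j hj
  let X : CExt τ := ⟨mk (0, 1, 0), 0⟩
  let Y : CExt τ := ⟨mk (0, 0, 1), 0⟩
  have hX : X ^ p = j (Additive.toMul c1) := by
    rw [CExt.pow_eq τ X (by simp [X, τmk]), jdef]
    ext
    · change mk (0, 1, 0) ^ p = mk (c1, 0)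
      rw [← mk_pow]
      refine congrArg Multiplicative.ofAdd (QuotientAddGroup.eq_iff_sub_mem.2 ?_)
      refine ⟨(-1, 0), ?_⟩
      simp [ρ]
    · simp [X]
  have hY : Y ^ p = j (Additive.toMul c2) := by
    rw [CExt.pow_eq τ Y (by simp [Y, τmk]), jdef]
    ext
    · change mk (0, 0, 1) ^ p = mk (c2, 0)
      rw [← mk_pow]
      refine congrArg Multiplicative.ofAdd (QuotientAddGroup.eq_iff_sub_mem.2 ?_)
      refine ⟨(0, -1), ?_⟩
      simp [ρ]
    · simp [Y]
  have hXY : (⁅X, Y⁆ ^ p).v = p := by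
    have h1 : (⁅X, Y⁆).p = 1 := by
      rw [CExt.comm_p, commutatorElement_eq_one_iff_mul_comm, mul_comm]
    rw [CExt.pow_eq τ _ (by rw [h1, τ.one_left]), CExt.comm_v]
    simp [X, Y, τmk]
  have hmem : ⁅X, Y⁆ ^ p ∈ Dominion j.range := by
    intro C _ hC f g hfg
    have e1 : f X ^ p = g X ^ p := by
      rw [← map_pow, ← map_pow, hX]
      exact hfg _ ⟨_, rfl⟩
    have e2 : f Y ^ p = g Y ^ p := by
      rw [← map_pow, ← map_pow, hY]
      exact hfg _ ⟨_, rfl⟩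
    rw [map_pow, map_pow, map_commutatorElement, map_commutatorElement, ← hC.comm_pow_left, e1,
      hC.comm_pow_left, ← hC.comm_pow_right, e2, hC.comm_pow_right]
  rw [hdom] at hmem
  obtain ⟨g, hg⟩ := hmem
  rw [← hg, jdef] at hXY
  have : ((p : ℕ) : ZMod (p ^ 2)) = 0 := hXY.symm
  rw [ZMod.natCast_eq_zero_iff] at this
  have := Nat.le_of_dvd hp.pos this
  nlinarith [hp.two_le]

end NonCyclic

/-- A finitely generated abelian group is absolutely closed in `N₂` iff it is cyclic. -/
theorem fg_abelian_absolutelyClosed_iff_isCyclic {G : Type u} [CommGroup G]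
    (hfg : Group.FG G) :
    IsAbsolutelyClosed G ↔ IsCyclic G := by
  constructor
  · intro h
    by_contra hc
    have hfg' : AddGroup.FG (Additive G) := GroupFG.iff_add_fg.1 hfg
    obtain ⟨p, hp, c1, c2, f1, f2, h11, h12, h21, h22, hz⟩ := exists_dual_pair (Additive G)
      (fun h' => hc (isAddCyclic_additive_iff.1 h'))
    exact not_absolutelyClosed G p hp c1 c2 f1 f2 h11 h12 h21 h22 hz h
  · intro h
    exact cyclic_absolutelyClosed G
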